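/- Let (f_0,…,f_5) be a rational solution of A_5(α_0,…,α_5) such that for some i ∈ {0,…,5}, f_i and f_{i+3} have a pole at t=∞ and f_{i+1}, f_{i+2}, f_{i+4}, f_{i+5} are holomorphic at t=∞. Then, as |t| → ∞: t·(f_i(t) − t) → α_{i+2} − α_{i+4}, t·f_{i+1}(t) → α_{i+1}, t·f_{i+2}(t) → −α_{i+2}, t·(f_{i+3}(t) − t) → α_{i+5} − α_{i+1}, t·f_{i+4}(t) → α_{i+4}, and t·f_{i+5}(t) → −α_{i+5}. In particular f_i and f_{i+3} have a pole of order one at t=∞ with leading coefficient 1. -/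

import Mathlib

open Filter Topology Polynomial

noncomputable section

/-- Evaluation of a complex rational function at a point (junk value where the
reduced denominator vanishes). -/
def evalR (f : RatFunc ℂ) (t : ℂ) : ℂ := RatFunc.eval (RingHom.id ℂ) t f

/-- `f` is defined at `t`: the reduced denominator does not vanish at `t`. -/
def DefinedAt (f : RatFunc ℂ) (t : ℂ) : Prop := Polynomial.eval t (RatFunc.denom f) ≠ 0

/-- `(f 0, …, f 5)` is a rational solution of the `A₅⁽¹⁾` Painlevé system `A₅(α)`:
the two constraints hold identically as rational functions, and the six ODEs hold at
every point where all six components are defined.  (Indices are taken in `Fin 6`,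
i.e. modulo `6`.) -/
def IsA5Solution (α : Fin 6 → ℂ) (f : Fin 6 → RatFunc ℂ) : Prop :=
  f 0 + f 2 + f 4 = RatFunc.X ∧
  f 1 + f 3 + f 5 = RatFunc.X ∧
  ∀ t : ℂ, (∀ j : Fin 6, DefinedAt (f j) t) → ∀ i : Fin 6,
    t / 2 * deriv (evalR (f i)) t =
      evalR (f i) t *
        (evalR (f (i + 1)) t * evalR (f (i + 2)) t
          + evalR (f (i + 1)) t * evalR (f (i + 4)) t
          + evalR (f (i + 3)) t * evalR (f (i + 4)) t
          - evalR (f (i + 2)) t * evalR (f (i + 3)) t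
          - evalR (f (i + 2)) t * evalR (f (i + 5)) t
          - evalR (f (i + 4)) t * evalR (f (i + 5)) t)
      + (1 / 2 - α (i + 2) - α (i + 4)) * evalR (f i) t
      + α i * (evalR (f (i + 2)) t + evalR (f (i + 4)) t)

/-- `f` has a pole at `t = ∞`: `‖f t‖ → ∞` as `‖t‖ → ∞`. -/
def PoleAtInfty (f : RatFunc ℂ) : Prop :=
  Tendsto (fun t => ‖evalR f t‖) (Bornology.cobounded ℂ) atTop

/-- `f` is holomorphic at `t = ∞`: `f` is bounded as `‖t‖ → ∞`. -/
def HoloAtInfty (f : RatFunc ℂ) : Prop :=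
  IsBoundedUnder (· ≤ ·) (Bornology.cobounded ℂ) fun t => ‖evalR f t‖

/-- `f` has a pole at `c ∈ ℂ`: `‖f t‖ → ∞` as `t → c`. -/
def PoleAt (f : RatFunc ℂ) (c : ℂ) : Prop :=
  Tendsto (fun t => ‖evalR f t‖) (𝓝[≠] c) atTop

/-- `f` is regular at `c ∈ ℂ`: it extends continuously to `c`. -/
def RegularAt (f : RatFunc ℂ) (c : ℂ) : Prop :=
  ∃ L : ℂ, Tendsto (fun t => evalR f t) (𝓝[≠] c) (𝓝 L)

/-- `z` is an integer. -/
def IsInt (z : ℂ) : Prop := ∃ n : ℤ, z = (n : ℂ)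

/-- `z` is an even integer. -/
def IsEvenInt (z : ℂ) : Prop := ∃ n : ℤ, z = 2 * (n : ℂ)

/-- A tuple of rational functions has pole configuration of Type A at `t = ∞`. -/
def TypeA (f : Fin 6 → RatFunc ℂ) : Prop :=
  ∃ i : Fin 6,
    (PoleAtInfty (f i) ∧ PoleAtInfty (f (i + 1)) ∧ HoloAtInfty (f (i + 2)) ∧
      HoloAtInfty (f (i + 3)) ∧ HoloAtInfty (f (i + 4)) ∧ HoloAtInfty (f (i + 5))) ∨
    (PoleAtInfty (f i) ∧ PoleAtInfty (f (i + 3)) ∧ HoloAtInfty (f (i + 1)) ∧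
      HoloAtInfty (f (i + 2)) ∧ HoloAtInfty (f (i + 4)) ∧ HoloAtInfty (f (i + 5))) ∨
    (PoleAtInfty (f i) ∧ PoleAtInfty (f (i + 1)) ∧ PoleAtInfty (f (i + 2)) ∧
      PoleAtInfty (f (i + 4)) ∧ HoloAtInfty (f (i + 3)) ∧ HoloAtInfty (f (i + 5)))

/-- A tuple of rational functions has pole configuration of Type B at `t = ∞`. -/
def TypeB (f : Fin 6 → RatFunc ℂ) : Prop :=
  ∃ i : Fin 6,
    PoleAtInfty (f i) ∧ PoleAtInfty (f (i + 1)) ∧ PoleAtInfty (f (i + 2)) ∧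
    PoleAtInfty (f (i + 3)) ∧ HoloAtInfty (f (i + 4)) ∧ HoloAtInfty (f (i + 5))


/-- A rational function is defined at all points of sufficiently large norm. -/
lemma eventually_definedAt (f : RatFunc ℂ) :
    ∀ᶠ t in Bornology.cobounded ℂ, DefinedAt f t := by
  have hfin : {t : ℂ | (RatFunc.denom f).IsRoot t}.Finite :=
    Polynomial.finite_setOfPred_isRoot (RatFunc.denom_ne_zero f)
  exact Bornology.isBounded_def.1 hfin.isBounded

lemma DefinedAt.differentiableAt {f : RatFunc ℂ} {t : ℂ} (h : DefinedAt f t) :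
    DifferentiableAt ℂ (evalR f) t := by
  have heq : evalR f = fun z => (RatFunc.num f).eval z / (RatFunc.denom f).eval z := rfl
  rw [heq]
  exact (RatFunc.num f).differentiableAt.fun_div (RatFunc.denom f).differentiableAt h

lemma evalR_add {f g : RatFunc ℂ} {t : ℂ} (hf : DefinedAt f t) (hg : DefinedAt g t) :
    evalR (f + g) t = evalR f t + evalR g t :=
  RatFunc.eval_add _ _ hf hg

lemma eventually_evalR_add_add {f g h : RatFunc ℂ} (hX : f + g + h = RatFunc.X) :
    ∀ᶠ t in Bornology.cobounded ℂ, evalR f t + evalR g t + evalR h t = t := by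
  filter_upwards [eventually_definedAt f, eventually_definedAt g, eventually_definedAt h,
    eventually_definedAt (f + g)] with t hf hg hh hfg
  rw [← evalR_add hf hg, ← evalR_add hfg hh, hX]
  exact RatFunc.eval_X (RingHom.id ℂ) t

/-- The derivative of a rational function holomorphic at `∞` tends to zero at `∞`. -/
lemma HoloAtInfty.tendsto_deriv {f : RatFunc ℂ} (hf : HoloAtInfty f) :
    Tendsto (deriv (evalR f)) (Bornology.cobounded ℂ) (𝓝 0) := by
  obtain ⟨M, hM⟩ := hf
  rw [eventually_map] at hM
  obtain ⟨r, -, hr⟩ := (hasBasis_cobounded_norm (E := ℂ)).eventually_iff.1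
    (hM.and (eventually_definedAt f))
  have hnorm : Tendsto (fun t : ℂ => ‖t‖) (Bornology.cobounded ℂ) atTop :=
    tendsto_norm_cobounded_atTop
  refine squeeze_zero_norm' (a := fun t => M / (‖t‖ / 2)) ?_
    ((hnorm.atTop_div_const two_pos).const_div_atTop M)
  filter_upwards [hnorm.eventually_ge_atTop (2 * r), hnorm.eventually_gt_atTop 0] with t ht ht0
  have hball : ∀ z ∈ Metric.closedBall t (‖t‖ / 2), r ≤ ‖z‖ := by
    intro z hz
    have hzt : ‖t - z‖ ≤ ‖t‖ / 2 := by
      rw [← dist_eq_norm, dist_comm]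
      exact hz
    have := norm_sub_norm_le t z
    linarith
  refine Complex.norm_deriv_le_of_forall_mem_sphere_norm_le (half_pos ht0) ?_
    fun z hz => (hr (hball z (Metric.sphere_subset_closedBall hz))).1
  refine DifferentiableOn.diffContOnCl_ball (U := Metric.closedBall t (‖t‖ / 2)) ?_ subset_rfl
  exact fun z hz => (hr (hball z hz)).2.differentiableAt.differentiableWithinAt

lemma HoloAtInfty.tendsto_div {f : RatFunc ℂ} (hf : HoloAtInfty f) :
    Tendsto (fun t => evalR f t / t) (Bornology.cobounded ℂ) (𝓝 0) := by
  simpa only [div_eq_mul_inv, mul_comm] using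
    (tendsto_inv₀_cobounded (α := ℂ)).zero_mul_isBoundedUnder_le hf

/-- If `(t/2) u' = u P + c u + β W` near `∞` with `u' → 0`, `P ~ s t²` and `W ~ t`, then
`u ~ -β / (s t)`. -/
lemma tendsto_mul_of_linear_ode {u P W : ℂ → ℂ} {c β s : ℂ} (hs : s ≠ 0)
    (hu : Tendsto (deriv u) (Bornology.cobounded ℂ) (𝓝 0))
    (hP : Tendsto (fun t => P t / t ^ 2) (Bornology.cobounded ℂ) (𝓝 s))
    (hW : Tendsto (fun t => W t / t) (Bornology.cobounded ℂ) (𝓝 1))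
    (hode : ∀ᶠ t in Bornology.cobounded ℂ,
      t / 2 * deriv u t = u t * P t + c * u t + β * W t) :
    Tendsto (fun t => t * u t) (Bornology.cobounded ℂ) (𝓝 (-β / s)) := by
  have hinv : Tendsto (fun t : ℂ => t⁻¹) (Bornology.cobounded ℂ) (𝓝 0) :=
    tendsto_inv₀_cobounded
  have hden : Tendsto (fun t => P t / t ^ 2 + c * t⁻¹ ^ 2) (Bornology.cobounded ℂ) (𝓝 s) := by
    simpa using hP.add ((hinv.pow 2).const_mul c)
  have hnum : Tendsto (fun t => deriv u t / 2 - β * (W t / t)) (Bornology.cobounded ℂ)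
      (𝓝 (-β)) := by
    simpa using (hu.div_const 2).sub (hW.const_mul β)
  refine (hnum.div hden hs).congr' ?_
  filter_upwards [hode, hden.eventually_ne hs, Bornology.eventually_ne_cobounded (0 : ℂ)]
    with t ht hne ht0
  rw [Pi.div_apply, div_eq_iff hne]
  field_simp
  linear_combination 2 * ht

/-- The system is invariant under cyclic shifts of the indices. -/
lemma IsA5Solution.shift {α : Fin 6 → ℂ} {f : Fin 6 → RatFunc ℂ} (h : IsA5Solution α f)
    (i : Fin 6) : IsA5Solution (fun j => α (i + j)) (fun j => f (i + j)) := by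
  obtain ⟨heven, hodd, hode⟩ := h
  have heven₂ := (add_rotate (f 0) (f 2) (f 4)).symm.trans heven
  have heven₄ := (add_rotate (f 2) (f 4) (f 0)).symm.trans heven₂
  have hodd₂ := (add_rotate (f 1) (f 3) (f 5)).symm.trans hodd
  have hodd₄ := (add_rotate (f 3) (f 5) (f 1)).symm.trans hodd₂
  refine ⟨?_, ?_, fun t ht k => ?_⟩
  · fin_cases i
    exacts [heven, hodd, heven₂, hodd₂, heven₄, hodd₄]
  · fin_cases i
    exacts [hodd, heven₂, hodd₂, heven₄, hodd₄, heven]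
  · have hdef : ∀ j, DefinedAt (f j) t := fun j => by simpa using ht (j - i)
    simpa only [add_assoc] using hode t hdef (i + k)

/-- The case of poles at `f 0` and `f 3`. -/
lemma IsA5Solution.tendsto_of_holoAtInfty {α : Fin 6 → ℂ} {f : Fin 6 → RatFunc ℂ}
    (hsol : IsA5Solution α f) (hh1 : HoloAtInfty (f 1)) (hh2 : HoloAtInfty (f 2))
    (hh4 : HoloAtInfty (f 4)) (hh5 : HoloAtInfty (f 5)) :
    Tendsto (fun t => t * (evalR (f 0) t - t)) (Bornology.cobounded ℂ) (𝓝 (α 2 - α 4)) ∧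
    Tendsto (fun t => t * evalR (f 1) t) (Bornology.cobounded ℂ) (𝓝 (α 1)) ∧
    Tendsto (fun t => t * evalR (f 2) t) (Bornology.cobounded ℂ) (𝓝 (-α 2)) ∧
    Tendsto (fun t => t * (evalR (f 3) t - t)) (Bornology.cobounded ℂ) (𝓝 (α 5 - α 1)) ∧
    Tendsto (fun t => t * evalR (f 4) t) (Bornology.cobounded ℂ) (𝓝 (α 4)) ∧
    Tendsto (fun t => t * evalR (f 5) t) (Bornology.cobounded ℂ) (𝓝 (-α 5)) := by
  obtain ⟨heven, hodd, hode⟩ := hsol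
  have hE := eventually_evalR_add_add heven
  have hO := eventually_evalR_add_add hodd
  have hode' := (eventually_all.2 fun j => eventually_definedAt (f j)).mono hode
  have g1 := hh1.tendsto_div
  have g2 := hh2.tendsto_div
  have g4 := hh4.tendsto_div
  have g5 := hh5.tendsto_div
  have g0 : Tendsto (fun t => evalR (f 0) t / t) (Bornology.cobounded ℂ) (𝓝 1) := by
    have h := (g2.add g4).const_sub 1
    rw [add_zero, sub_zero] at h
    refine h.congr' ?_
    filter_upwards [hE, Bornology.eventually_ne_cobounded (0 : ℂ)] with t ht ht0
    field_simp
    linear_combination -ht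
  have g3 : Tendsto (fun t => evalR (f 3) t / t) (Bornology.cobounded ℂ) (𝓝 1) := by
    have h := (g1.add g5).const_sub 1
    rw [add_zero, sub_zero] at h
    refine h.congr' ?_
    filter_upwards [hO, Bornology.eventually_ne_cobounded (0 : ℂ)] with t ht ht0
    field_simp
    linear_combination -ht
  have quad : ∀ {a b c d e : ℂ → ℂ} {A B C D E : ℂ},
      Tendsto (fun t => a t / t) (Bornology.cobounded ℂ) (𝓝 A) →
      Tendsto (fun t => b t / t) (Bornology.cobounded ℂ) (𝓝 B) →
      Tendsto (fun t => c t / t) (Bornology.cobounded ℂ) (𝓝 C) →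
      Tendsto (fun t => d t / t) (Bornology.cobounded ℂ) (𝓝 D) →
      Tendsto (fun t => e t / t) (Bornology.cobounded ℂ) (𝓝 E) →
      Tendsto (fun t => (a t * b t + a t * d t + c t * d t - b t * c t - b t * e t
        - d t * e t) / t ^ 2) (Bornology.cobounded ℂ)
        (𝓝 (A * B + A * D + C * D - B * C - B * E - D * E)) := by
    intro a b c d e A B C D E ha hb hc hd he
    refine ((((((ha.mul hb).add (ha.mul hd)).add (hc.mul hd)).sub (hb.mul hc)).sub
      (hb.mul he)).sub (hd.mul he)).congr fun t => ?_
    ring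
  have lin : ∀ {a b : ℂ → ℂ} {A B : ℂ},
      Tendsto (fun t => a t / t) (Bornology.cobounded ℂ) (𝓝 A) →
      Tendsto (fun t => b t / t) (Bornology.cobounded ℂ) (𝓝 B) → A + B = 1 →
      Tendsto (fun t => (a t + b t) / t) (Bornology.cobounded ℂ) (𝓝 1) := by
    intro a b A B ha hb hAB
    simpa only [add_div, hAB] using ha.add hb
  have l1 : Tendsto (fun t => t * evalR (f 1) t) (Bornology.cobounded ℂ) (𝓝 (α 1)) := by
    have h := tendsto_mul_of_linear_ode (by norm_num) hh1.tendsto_deriv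
      (quad g2 g3 g4 g5 g0) (lin g3 g5 (by norm_num)) (hode'.mono fun t ht => ht 1)
    simpa using h
  have l2 : Tendsto (fun t => t * evalR (f 2) t) (Bornology.cobounded ℂ) (𝓝 (-α 2)) := by
    have h := tendsto_mul_of_linear_ode (by norm_num) hh2.tendsto_deriv
      (quad g3 g4 g5 g0 g1) (lin g4 g0 (by norm_num)) (hode'.mono fun t ht => ht 2)
    simpa using h
  have l4 : Tendsto (fun t => t * evalR (f 4) t) (Bornology.cobounded ℂ) (𝓝 (α 4)) := by
    have h := tendsto_mul_of_linear_ode (by norm_num) hh4.tendsto_deriv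
      (quad g5 g0 g1 g2 g3) (lin g0 g2 (by norm_num)) (hode'.mono fun t ht => ht 4)
    simpa using h
  have l5 : Tendsto (fun t => t * evalR (f 5) t) (Bornology.cobounded ℂ) (𝓝 (-α 5)) := by
    have h := tendsto_mul_of_linear_ode (by norm_num) hh5.tendsto_deriv
      (quad g0 g1 g2 g3 g4) (lin g1 g3 (by norm_num)) (hode'.mono fun t ht => ht 5)
    simpa using h
  refine ⟨?_, l1, l2, ?_, l4, l5⟩
  · have h := (l2.add l4).neg
    rw [show -(-α 2 + α 4) = α 2 - α 4 by ring] at h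
    refine h.congr' (hE.mono fun t ht => ?_)
    linear_combination -t * ht
  · have h := (l1.add l5).neg
    rw [show -(α 1 + -α 5) = α 5 - α 1 by ring] at h
    refine h.congr' (hO.mono fun t ht => ?_)
    linear_combination -t * ht

/-- Laurent behaviour at `t = ∞` for a Type A (2) rational solution. -/
theorem stmt_3 (α : Fin 6 → ℂ) (f : Fin 6 → RatFunc ℂ) (i : Fin 6)
    (hsum : α 0 + α 1 + α 2 + α 3 + α 4 + α 5 = 1)
    (hsol : IsA5Solution α f)
    (hpi : PoleAtInfty (f i)) (hpi3 : PoleAtInfty (f (i + 3)))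
    (hh1 : HoloAtInfty (f (i + 1))) (hh2 : HoloAtInfty (f (i + 2)))
    (hh4 : HoloAtInfty (f (i + 4))) (hh5 : HoloAtInfty (f (i + 5))) :
    Tendsto (fun t => t * (evalR (f i) t - t)) (Bornology.cobounded ℂ)
        (𝓝 (α (i + 2) - α (i + 4))) ∧
    Tendsto (fun t => t * evalR (f (i + 1)) t) (Bornology.cobounded ℂ) (𝓝 (α (i + 1))) ∧
    Tendsto (fun t => t * evalR (f (i + 2)) t) (Bornology.cobounded ℂ) (𝓝 (-α (i + 2))) ∧
    Tendsto (fun t => t * (evalR (f (i + 3)) t - t)) (Bornology.cobounded ℂ)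
        (𝓝 (α (i + 5) - α (i + 1))) ∧
    Tendsto (fun t => t * evalR (f (i + 4)) t) (Bornology.cobounded ℂ) (𝓝 (α (i + 4))) ∧
    Tendsto (fun t => t * evalR (f (i + 5)) t) (Bornology.cobounded ℂ) (𝓝 (-α (i + 5))) := by
  simpa only [add_zero] using (hsol.shift i).tendsto_of_holoAtInfty hh1 hh2 hh4 hh5
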